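/- Let R be a finite 2-group that is not cyclic, and suppose there exists a subgroup H of R such that every automorphism of R fixing H setwise is a power automorphism. Then the center Z(R) of R has order exactly 2. -/

import Mathlib

open scoped commutatorElement

lemma aux_order4 {G : Type*} [Group G] (hp : IsPGroup 2 G) (w : G) (hw : w ^ 2 ≠ 1) :
    ∃ k : ℕ, (w ^ k) ^ 4 = 1 ∧ (w ^ k) ^ 2 ≠ 1 := by
  classical
  have hex : ∃ k : ℕ, w ^ 2 ^ k = 1 := isPGroup_iff_pow_pow_eq_one.1 hp w
  have h1 := Nat.find_spec hex
  have h2 : ∀ m, m < Nat.find hex → ¬ w ^ 2 ^ m = 1 := fun m hm => Nat.find_min hex hm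
  generalize Nat.find hex = k at h1 h2
  match k, h1, h2 with
  | 0, h1, _ => exact absurd (by simp at h1; simp [h1]) hw
  | 1, h1, _ => exact absurd (by simpa using h1) hw
  | k + 2, h1, h2 =>
    refine ⟨2 ^ k, ?_, ?_⟩
    · rw [← pow_mul, ← h1]; congr 1; ring
    · intro h
      apply h2 (k + 1) (by omega)
      rw [← h, ← pow_mul]; congr 1

lemma aux_cyclic {G : Type*} [Group G] [Finite G] (hp : IsPGroup 2 G) (u : G)
    (hu : ∀ g, g * u = u * g) (hx : ∀ x : G, x ^ 4 = 1 → x ∈ Subgroup.zpowers u) :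
    IsCyclic G := by
  classical
  have : Fact (Nat.Prime 2) := ⟨Nat.prime_two⟩
  have : Group.IsNilpotent G := hp.isNilpotent
  have hcen : ∀ y ∈ Subgroup.zpowers u, ∀ g, g * y = y * g := by
    rintro y ⟨n, rfl⟩ g
    exact ((show Commute g u from hu g).zpow_right n)
  obtain ⟨a, ha, hmax⟩ := Set.Finite.exists_maximalFor (fun a : G => Subgroup.zpowers a)
    {a : G | u ∈ Subgroup.zpowers a} (Set.toFinite _) ⟨u, Subgroup.mem_zpowers u⟩
  simp only [Set.mem_setOf_eq] at ha hmax
  by_cases htop : Subgroup.zpowers a = ⊤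
  · exact ⟨a, fun x => by
      have : x ∈ (⊤ : Subgroup G) := Subgroup.mem_top x
      rwa [← htop] at this⟩
  exfalso
  have hlt := normalizerCondition_of_isNilpotent (G := G) (Subgroup.zpowers a)
    (lt_top_iff_ne_top.2 htop)
  obtain ⟨x0, hx0N, hx0⟩ := SetLike.exists_of_lt hlt
  -- an element of the normalizer with square inside
  obtain ⟨x, hxN, hxA, hx2⟩ : ∃ x, x ∈ Subgroup.normalizer (Subgroup.zpowers a : Set G) ∧
      x ∉ Subgroup.zpowers a ∧ x ^ 2 ∈ Subgroup.zpowers a := by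
    have hex : ∃ k : ℕ, x0 ^ 2 ^ k ∈ Subgroup.zpowers a := by
      obtain ⟨k, hk⟩ := isPGroup_iff_pow_pow_eq_one.1 hp x0
      exact ⟨k, hk ▸ one_mem _⟩
    have h1 := Nat.find_spec hex
    have h2 : ∀ m, m < Nat.find hex → ¬ x0 ^ 2 ^ m ∈ Subgroup.zpowers a :=
      fun m hm => Nat.find_min hex hm
    generalize Nat.find hex = k at h1 h2
    match k, h1, h2 with
    | 0, h1, _ => exact absurd (by simpa using h1) hx0
    | k + 1, h1, h2 =>
      refine ⟨x0 ^ 2 ^ k, pow_mem hx0N _, h2 k (by omega), ?_⟩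
      rw [← pow_mul, ← pow_succ]; exact h1
  have hcomm : ∀ b ∈ Subgroup.zpowers a, ∀ c ∈ Subgroup.zpowers a, b * c = c * b := by
    rintro _ ⟨m, rfl⟩ _ ⟨n, rfl⟩
    exact ((Commute.refl a).zpow_zpow m n)
  obtain ⟨j, hj⟩ := mem_powers_iff_mem_zpowers.2 hx2
  simp only at hj
  rcases Nat.even_or_odd j with ⟨i, rfl⟩ | hodd
  · set b := a ^ i with hb
    have hbA : b ∈ Subgroup.zpowers a := pow_mem (Subgroup.mem_zpowers a) _
    have hxx : x * x = b * b := by rw [← pow_two x, ← hj, pow_add]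
    set d := x * b * x⁻¹ * b⁻¹ with hd
    have hdA : d ∈ Subgroup.zpowers a :=
      mul_mem ((Subgroup.mem_normalizer_iff.1 hxN b).1 hbA) (inv_mem hbA)
    have hdb : d * b = b * d := hcomm _ hdA _ hbA
    have hxb : x * b * x⁻¹ = d * b := by simp [hd]
    have hinv : x * d * x⁻¹ = d⁻¹ := by
      calc x * d * x⁻¹ = (x * x) * b * (x * x)⁻¹ * (x * b * x⁻¹)⁻¹ := by rw [hd]; group
        _ = b * (d * b)⁻¹ := by rw [hxx, hxb]; group
        _ = d⁻¹ := by group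
    have hd2 : d ^ 2 = 1 := by
      by_contra hne
      obtain ⟨k, hk4, hk2⟩ := aux_order4 hp d hne
      have h1 := hcen _ (hx _ hk4) x
      have h2 : x * d ^ k * x⁻¹ = (d ^ k)⁻¹ := by
        rw [← conj_pow, hinv, inv_pow]
      rw [h1, mul_inv_cancel_right] at h2
      apply hk2
      rw [pow_two]; nth_rewrite 1 [h2]; simp
    have hy2 : (x * b⁻¹) ^ 2 = d⁻¹ := by
      calc (x * b⁻¹) ^ 2 = (x * b * x⁻¹)⁻¹ * (x * x) * b⁻¹ := by rw [pow_two]; group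
        _ = b⁻¹ * d⁻¹ * b := by rw [hxx, hxb]; group
        _ = (d * b)⁻¹ * b := by group
        _ = (b * d)⁻¹ * b := by rw [hdb]
        _ = d⁻¹ * b⁻¹ * b := by group
        _ = d⁻¹ := by group
    have hy4 : (x * b⁻¹) ^ 4 = 1 := by
      rw [show 4 = 2 * 2 from rfl, pow_mul, hy2, inv_pow, hd2, inv_one]
    have hyA : x * b⁻¹ ∈ Subgroup.zpowers a :=
      (Subgroup.zpowers_le.2 ha) (hx _ hy4)
    apply hxA
    have := mul_mem hyA hbA
    simpa using this
  · obtain ⟨k, hk⟩ := IsPGroup.iff_orderOf.1 hp a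
    have hcop : Nat.Coprime j (orderOf a) := by
      rw [hk]; exact Nat.Coprime.pow_right _ (Nat.coprime_two_right.2 hodd)
    obtain ⟨m, hm⟩ := exists_pow_eq_self_of_coprime hcop
    have hax : a ∈ Subgroup.zpowers x := by
      rw [← hm, hj]
      exact pow_mem (pow_mem (Subgroup.mem_zpowers x) _) _
    have hle : Subgroup.zpowers a ≤ Subgroup.zpowers x := Subgroup.zpowers_le.2 hax
    exact hxA (hmax (hle ha) hle (Subgroup.mem_zpowers x))

lemma aux_shear {R : Type*} [Group R] [Finite R] (H : Subgroup R)
    (hH : ∀ α : MulAut R, Subgroup.map α.toMonoidHom H = H →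
      ∀ x : R, α x ∈ Subgroup.zpowers x) (M : Subgroup R)
    (hM : ∀ x y, x ∉ M → y ∉ M → x * y ∈ M) (hHM : H ≤ M ∨ H = ⊤) (v : R) (hv : v ∈ M)
    (hc : ∀ m ∈ M, m * v = v * m) (hi : ∀ g, g ∉ M → v * g * v = g) :
    ∀ g, g ∉ M → v ∈ Subgroup.zpowers g := by
  classical
  let f : R →* R := MonoidHom.mk' (fun x => if x ∈ M then x else x * v) (by
    intro x y
    by_cases hx : x ∈ M <;> by_cases hy : y ∈ M
    · simp [hx, hy, mul_mem hx hy]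
    · have : x * y ∉ M := fun h => hy ((Subgroup.mul_mem_cancel_left M hx).1 h)
      simp [hx, hy, this, mul_assoc]
    · have : x * y ∉ M := fun h => hx ((Subgroup.mul_mem_cancel_right M hy).1 h)
      simp [hx, hy, this, mul_assoc, hc y hy]
    · have := hM x y hx hy
      simp only [hx, hy, this, if_true, if_false]
      rw [mul_assoc, ← mul_assoc v, hi y hy])
  have hf1 : ∀ x, x ∈ M → f x = x := fun x hx => by simp [f, hx]
  have hf2 : ∀ x, x ∉ M → f x = x * v := fun x hx => by simp [f, hx]
  have hinj : Function.Injective f := by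
    rw [injective_iff_map_eq_one]
    intro x hx
    by_cases h : x ∈ M
    · rwa [hf1 x h] at hx
    · rw [hf2 x h] at hx
      exact absurd (eq_inv_of_mul_eq_one_left hx ▸ inv_mem hv) h
  let α : MulAut R := MulEquiv.ofBijective f (Finite.injective_iff_bijective.1 hinj)
  have hα : ∀ x, α x = f x := fun x => rfl
  have hmap : Subgroup.map α.toMonoidHom H = H := by
    rcases hHM with h | h
    · ext y
      constructor
      · rintro ⟨x, hx, rfl⟩
        change f x ∈ H
        rw [hf1 x (h hx)]; exact hx
      · intro hy
        exact ⟨y, hy, hf1 y (h hy)⟩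
    · subst h
      exact Subgroup.map_top_of_surjective _ α.surjective
  intro g hg
  have := hH α hmap g
  rw [hα, hf2 g hg] at this
  exact (Subgroup.mul_mem_cancel_left _ (Subgroup.mem_zpowers g)).1 this

/-- a cyclic group has at most one involution -/
lemma aux_one_inv {R : Type*} [Group R] [Finite R] (g s t : R) (hs : s ∈ Subgroup.zpowers g)
    (ht : t ∈ Subgroup.zpowers g) (hs1 : s ≠ 1) (ht1 : t ≠ 1) (hs2 : s ^ 2 = 1) (ht2 : t ^ 2 = 1) :
    s = t := by
  classical
  by_contra hne
  have := Fintype.ofFinite (Subgroup.zpowers g)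
  have hle := IsCyclic.card_pow_eq_one_le (α := Subgroup.zpowers g) (n := 2) (by norm_num)
  have h3 : ({1, ⟨s, hs⟩, ⟨t, ht⟩} : Finset (Subgroup.zpowers g)).card = 3 := by
    rw [Finset.card_eq_three]
    refine ⟨_, _, _, ?_, ?_, ?_, rfl⟩
    · intro h; exact hs1 (congrArg Subtype.val h).symm
    · intro h; exact ht1 (congrArg Subtype.val h).symm
    · intro h; exact hne (congrArg Subtype.val h)
  have : ({1, ⟨s, hs⟩, ⟨t, ht⟩} : Finset (Subgroup.zpowers g)) ⊆
      Finset.univ.filter (fun a => a ^ 2 = 1) := by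
    intro y hy
    simp only [Finset.mem_insert, Finset.mem_singleton] at hy
    simp only [Finset.mem_filter, Finset.mem_univ, true_and]
    rcases hy with rfl | rfl | rfl
    · simp
    · exact Subtype.ext (by simpa using hs2)
    · exact Subtype.ext (by simpa using ht2)
  have := Finset.card_le_card this
  omega

lemma aux_unique {R : Type*} [Group R] [Finite R] [Nontrivial R]
    (hpR : IsPGroup 2 R) (H : Subgroup R)
    (hH : ∀ α : MulAut R, Subgroup.map α.toMonoidHom H = H →
      ∀ x : R, α x ∈ Subgroup.zpowers x) (s t : R) (hs : s ∈ Subgroup.center R)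
    (ht : t ∈ Subgroup.center R) (hs1 : s ≠ 1) (ht1 : t ≠ 1) (hs2 : s ^ 2 = 1) (ht2 : t ^ 2 = 1) :
    s = t := by
  have : Fact (Nat.Prime 2) := ⟨Nat.prime_two⟩
  obtain ⟨n, hn0, hn⟩ := (IsPGroup.nontrivial_iff_card hpR).1 inferInstance
  obtain ⟨m, rfl⟩ : ∃ m, n = m + 1 := ⟨n - 1, by omega⟩
  obtain ⟨M, hMc, hHM⟩ : ∃ M : Subgroup R, Nat.card M = 2 ^ m ∧ (H ≤ M ∨ H = ⊤) := by
    by_cases hT : H = ⊤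
    · obtain ⟨M, hM⟩ := Sylow.exists_subgroup_card_pow_prime 2 (G := R) (n := m)
        (by rw [hn]; exact pow_dvd_pow _ (by omega))
      exact ⟨M, hM, Or.inr hT⟩
    · obtain ⟨k, hk⟩ := IsPGroup.iff_card.1 (hpR.to_subgroup H)
      have hkm : k ≤ m := by
        by_contra hlt
        apply hT
        apply Subgroup.eq_top_of_le_card
        rw [hn, hk]
        exact Nat.pow_le_pow_right (by norm_num) (by omega)
      obtain ⟨M, hM, hle⟩ := Sylow.exists_subgroup_card_pow_prime_le 2 (G := R) (m := m)
        (by rw [hn]; exact pow_dvd_pow _ (by omega)) H hk hkm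
      exact ⟨M, hM, Or.inl hle⟩
  have hidx : M.index = 2 := by
    have := M.card_mul_index
    rw [hMc, hn, pow_succ] at this
    exact Nat.eq_of_mul_eq_mul_left (by positivity) this
  have hM : ∀ x y, x ∉ M → y ∉ M → x * y ∈ M := fun x y hx hy => by
    rw [Subgroup.mul_mem_iff_of_index_two hidx]; tauto
  obtain ⟨g, hg⟩ : ∃ g, g ∉ M := by
    by_contra! h
    have : M = ⊤ := (Subgroup.eq_top_iff' M).2 h
    rw [this] at hidx; simp at hidx
  have key : ∀ v ∈ Subgroup.center R, v ^ 2 = 1 → v ∈ M → ∀ g, g ∉ M → v ∈ Subgroup.zpowers g := by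
    intro v hv hv2 hvM
    rw [Subgroup.mem_center_iff] at hv
    refine aux_shear H hH M hM hHM v hvM (fun m _ => hv m) (fun g _ => ?_)
    rw [← hv g, mul_assoc, ← pow_two, hv2, mul_one]
  have key2 : ∀ s t : R, s ∈ Subgroup.center R → t ∈ Subgroup.center R → s ≠ 1 → t ≠ 1 →
      s ^ 2 = 1 → t ^ 2 = 1 → s ∈ M → s = t := by
    intro s t hs ht hs1 ht1 hs2 ht2 hsM
    by_cases htM : t ∈ M
    · exact aux_one_inv g s t (key s hs hs2 hsM g hg) (key t ht ht2 htM g hg) hs1 ht1 hs2 ht2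
    · exact aux_one_inv t s t (key s hs hs2 hsM t htM) (Subgroup.mem_zpowers t) hs1 ht1 hs2 ht2
  by_cases hsM : s ∈ M
  · exact key2 s t hs ht hs1 ht1 hs2 ht2 hsM
  by_cases htM : t ∈ M
  · exact (key2 t s ht hs ht1 hs1 ht2 hs2 htM).symm
  by_contra hne
  have hst2 : (s * t) ^ 2 = 1 := by
    rw [(show Commute s t from Subgroup.mem_center_iff.1 ht s).mul_pow, hs2, ht2, one_mul]
  have hst1 : s * t ≠ 1 := by
    intro h
    apply hne
    have : t * t = 1 := by rw [← pow_two, ht2]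
    exact mul_right_cancel (h.trans this.symm)
  have := key2 (s * t) s (mul_mem hs ht) hs hst1 hs1 hst2 hs2 (hM s t hsM htM)
  exact ht1 (by simpa using this)

/-- Let `R` be a finite non-cyclic `2`-group admitting a subgroup `H` such that every
automorphism of `R` fixing `H` setwise is a power automorphism.  Then the center
`Z(R)` has order exactly `2`. -/
theorem stmt15 (R : Type*) [Group R] [Finite R]
    (hpR : IsPGroup 2 R) (hnc : ¬ IsCyclic R) (H : Subgroup R)
    (hH : ∀ α : MulAut R, Subgroup.map α.toMonoidHom H = H →
      ∀ x : R, α x ∈ Subgroup.zpowers x) :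
    Nat.card (Subgroup.center R) = 2 := by
  classical
  have : Fact (Nat.Prime 2) := ⟨Nat.prime_two⟩
  have : Group.IsNilpotent R := hpR.isNilpotent
  have : Nontrivial R := by
    by_contra h
    rw [not_nontrivial_iff_subsingleton] at h
    exact hnc inferInstance
  have huniq := aux_unique hpR H hH
  by_cases hel : ∀ x ∈ Subgroup.center R, x ^ 2 = 1
  · have := hpR.center_nontrivial
    obtain ⟨⟨z, hz⟩, hz1⟩ := exists_ne (1 : Subgroup.center R)
    rw [Nat.card_eq_two_iff]
    refine ⟨⟨z, hz⟩, 1, hz1, ?_⟩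
    rw [Set.eq_univ_iff_forall]
    rintro ⟨x, hx⟩
    by_cases hx1 : x = 1
    · right; exact Subtype.ext hx1
    · left
      refine Subtype.ext (huniq x z hx hz hx1 (fun h => hz1 (Subtype.ext h)) (hel x hx) (hel z hz))
  exfalso
  push Not at hel
  obtain ⟨u0, hu0, hu02⟩ := hel
  obtain ⟨k, hk4, hk2⟩ := aux_order4 hpR u0 hu02
  obtain ⟨u, huZ, hu4, hu2⟩ : ∃ u ∈ Subgroup.center R, u ^ 4 = 1 ∧ u ^ 2 ≠ 1 :=
    ⟨_, pow_mem hu0 k, hk4, hk2⟩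
  have huc : ∀ g, g * u = u * g := Subgroup.mem_center_iff.1 huZ
  have hcz : ∀ x ∈ Subgroup.center R, x ^ 2 = 1 → x = 1 ∨ x = u ^ 2 := by
    intro x hx hx2
    by_cases hx1 : x = 1
    · exact Or.inl hx1
    · exact Or.inr (huniq x (u ^ 2) hx (pow_mem huZ 2) hx1 hu2 hx2 (by rw [← pow_mul]; exact hu4))
  -- the normalizer
  obtain ⟨K, hKdef⟩ : ∃ K : Subgroup R, K = Subgroup.normalizer (H : Set R) := ⟨_, rfl⟩
  have hK1 : ∀ k ∈ K, ∀ x, k * x * k⁻¹ ∈ Subgroup.zpowers x := by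
    intro k hk x
    rw [hKdef, Subgroup.mem_normalizer_iff_map_conj_eq] at hk
    exact hH (MulAut.conj k) hk x
  have hK2 : ∀ k, (∀ x, k * x * k⁻¹ ∈ Subgroup.zpowers x) → k ∈ K := by
    intro k hk
    rw [hKdef]
    apply Subgroup.mem_normalizer_fintype
    intro n hn
    exact (Subgroup.zpowers_le.2 hn) (hk n)
  have hHK : H ≤ K := hKdef ▸ Subgroup.le_normalizer
  have hZK : Subgroup.center R ≤ K := by
    intro x hx
    apply hK2
    intro y
    rw [← Subgroup.mem_center_iff.1 hx y]; simp
  have hKn : ∀ k ∈ K, ∀ g, g * k * g⁻¹ ∈ K := by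
    intro k hk g
    apply hK2
    intro x
    obtain ⟨n, hn⟩ := hK1 k hk (g⁻¹ * x * g)
    refine ⟨n, ?_⟩
    simp only at hn ⊢
    have h1 : (g⁻¹ * x * g) ^ n = g⁻¹ * x ^ n * g := by
      have := conj_zpow (a := g⁻¹) (b := x) (i := n)
      simpa using this
    rw [h1] at hn
    calc x ^ n = g * (g⁻¹ * x ^ n * g) * g⁻¹ := by group
      _ = _ := by rw [hn]; group
  -- involutions of K are centralized by K
  have hKcomm : ∀ t, t ^ 2 = 1 → ∀ k ∈ K, k * t = t * k := by
    intro t ht k hk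
    by_cases ht1 : t = 1
    · simp [ht1]
    have := aux_one_inv t (k * t * k⁻¹) t (hK1 k hk t) (Subgroup.mem_zpowers t)
      (by simpa using ht1) ht1 (by rw [conj_pow, ht]; simp) ht
    exact mul_inv_eq_iff_eq_mul.1 this
  -- involutions of K are central
  have hinv : ∀ t ∈ K, t ^ 2 = 1 → t ∈ Subgroup.center R := by
    by_contra hcon
    push Not at hcon
    obtain ⟨t0, ht0K, ht02, ht0Z⟩ := hcon
    obtain ⟨t, htK, ht2, htZ, htc⟩ : ∃ t ∈ K, t ^ 2 = 1 ∧ t ∉ Subgroup.center R ∧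
        ∀ g, ⁅t, g⁆ ∈ Subgroup.center R := by
      have hex : ∃ n, ∃ t ∈ K, t ^ 2 = 1 ∧ t ∉ Subgroup.center R ∧
          t ∈ Subgroup.upperCentralSeries R n := by
        obtain ⟨n, hn⟩ := Group.IsNilpotent.nilpotent' (G := R)
        exact ⟨n, t0, ht0K, ht02, ht0Z, by rw [hn]; trivial⟩
      have h1 := Nat.find_spec hex
      have h2 := fun m (hm : m < Nat.find hex) => Nat.find_min hex hm
      generalize Nat.find hex = n at h1 h2
      obtain ⟨t, htK, ht2, htZ, htn⟩ := h1
      match n, htn, h2 with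
      | 0, htn, _ =>
        simp at htn
        exact absurd (htn ▸ one_mem _) htZ
      | n + 1, htn, h2 =>
        refine ⟨t, htK, ht2, htZ, fun g => ?_⟩
        by_contra hg
        apply h2 n (by omega)
        have hgK : g * t⁻¹ * g⁻¹ ∈ K := hKn _ (inv_mem htK) g
        have he : ⁅t, g⁆ = t * (g * t⁻¹ * g⁻¹) := by rw [commutatorElement_def]; group
        refine ⟨⁅t, g⁆, ?_, ?_, hg, Subgroup.mem_upperCentralSeries_succ_iff.1 htn g⟩
        · rw [he]; exact mul_mem htK hgK
        · have hc : Commute t (g * t⁻¹ * g⁻¹) := (hKcomm t ht2 _ hgK).symm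
          rw [he, hc.mul_pow, conj_pow, inv_pow, ht2]; simp
    have htt : t * t = 1 := by rw [← pow_two, ht2]
    have huu : u * u = u ^ 2 := (pow_two u).symm
    have hzz : u ^ 2 * u ^ 2 = 1 := by rw [← pow_add]; exact hu4
    have hz : ∀ g, g * u ^ 2 = u ^ 2 * g := Subgroup.mem_center_iff.1 (pow_mem huZ 2)
    -- g t = t g or t g = z g t
    have hdich : ∀ g, t * g = g * t ∨ t * g = u ^ 2 * (g * t) := by
      intro g
      have hw := htc g
      have hwc := Subgroup.mem_center_iff.1 hw
      have e1 : t * g = ⁅t, g⁆ * (g * t) := by rw [commutatorElement_def]; group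
      have hw2 : ⁅t, g⁆ ^ 2 = 1 := by
        generalize ⁅t, g⁆ = w at *
        have : g = w ^ 2 * g := by
          calc g = t * (t * g) := by rw [← mul_assoc, htt, one_mul]
            _ = t * w * (g * t) := by rw [e1, mul_assoc]
            _ = w * (t * g) * t := by rw [hwc t]; group
            _ = w * w * g * (t * t) := by rw [e1]; group
            _ = w ^ 2 * g := by rw [htt, mul_one, pow_two]
        exact mul_eq_right.1 this.symm
      rcases hcz _ hw hw2 with h | h
      · left; rw [e1, h, one_mul]
      · right; rw [← h]; exact e1
    let M : Subgroup R := Subgroup.centralizer {t}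
    have hMmem : ∀ g, g ∈ M ↔ t * g = g * t := by
      intro g
      simp [M, Subgroup.mem_centralizer_singleton_iff, eq_comm]
    have hnM : ∀ g, g ∉ M → t * g = u ^ 2 * (g * t) := by
      intro g hg
      rw [hMmem] at hg
      exact (hdich g).resolve_left hg
    have hres := aux_shear H hH M (by
        intro x y hx hy
        rw [hMmem]
        calc t * (x * y) = (t * x) * y := by group
          _ = u ^ 2 * x * (t * y) := by rw [hnM x hx]; group
          _ = u ^ 2 * (x * u ^ 2) * (y * t) := by rw [hnM y hy]; group
          _ = (u ^ 2 * u ^ 2) * (x * y * t) := by rw [hz x]; group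
          _ = x * y * t := by rw [hzz, one_mul])
      (Or.inl (fun h hh => (hMmem h).2 (hKcomm t ht2 h (hHK hh)).symm)) (t * u)
      ((hMmem _).2 (by rw [mul_assoc t u t, ← huc t]))
      (by
        intro m hm
        rw [hMmem] at hm
        rw [← mul_assoc, ← hm, mul_assoc, huc m, mul_assoc])
      (by
        intro g hg
        calc t * u * g * (t * u) = t * (u * g) * t * u := by group
          _ = (t * g) * (u * t) * u := by rw [← huc g]; group
          _ = u ^ 2 * g * (t * t) * (u * u) := by rw [hnM g hg, ← huc t]; group
          _ = u ^ 2 * (g * u ^ 2) := by rw [htt, huu]; group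
          _ = (u ^ 2 * u ^ 2) * g := by rw [hz g]; group
          _ = g := by rw [hzz, one_mul])
    apply htZ
    rw [Subgroup.mem_center_iff]
    intro g
    by_cases hg : g ∈ M
    · exact ((hMmem g).1 hg).symm
    · obtain ⟨n, hn⟩ := hres g hg
      simp only at hn
      have h1 : Commute g (t * u) := hn ▸ (Commute.refl g).zpow_right n
      have h2 : Commute g (t * u * u⁻¹) := h1.mul_right (show Commute g u from huc g).inv_right
      simpa using h2.eq
  -- K is cyclic
  have hK4 : ∀ x ∈ K, x ^ 4 = 1 → x ∈ Subgroup.zpowers u := by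
    have h2 : ∀ x ∈ K, x ^ 2 = 1 → x ∈ Subgroup.zpowers u := by
      intro x hx hx2
      rcases hcz x (hinv x hx hx2) hx2 with h | h
      · rw [h]; exact one_mem _
      · rw [h]; exact pow_mem (Subgroup.mem_zpowers u) 2
    intro x hx hx4
    have hxx : (x ^ 2) ^ 2 = 1 := by rw [← pow_mul]; exact hx4
    rcases hcz _ (hinv _ (pow_mem hx 2) hxx) hxx with h | h
    · exact h2 x hx h
    · have := h2 (x * u) (mul_mem hx (hZK huZ)) (by
        rw [(show Commute x u from huc x).mul_pow, h, ← pow_add]; exact hu4)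
      exact (Subgroup.mul_mem_cancel_right _ (Subgroup.mem_zpowers u)).1 this
  have hKcyc : IsCyclic K := by
    refine aux_cyclic (hpR.to_subgroup K) ⟨u, hZK huZ⟩ (fun g => Subtype.ext (huc g)) ?_
    rintro ⟨x, hx⟩ hx4
    obtain ⟨n, hn⟩ := hK4 x hx (by simpa using congrArg Subtype.val hx4)
    exact ⟨n, Subtype.ext (by simpa using hn)⟩
  obtain ⟨⟨a, haK⟩, ha⟩ := hKcyc
  have ha' : ∀ x ∈ K, ∃ n : ℤ, a ^ n = x := by
    intro x hx
    obtain ⟨n, hn⟩ := ha ⟨x, hx⟩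
    exact ⟨n, by simpa using congrArg Subtype.val hn⟩
  have hKtop : ∀ g, g ∈ K := by
    intro g
    rw [hKdef]
    apply Subgroup.mem_normalizer_fintype
    intro h hh
    obtain ⟨m, hm⟩ := ha' _ (hKn a haK g)
    obtain ⟨i, rfl⟩ := ha' h (hHK hh)
    rw [← conj_zpow, ← hm, ← zpow_mul, mul_comm, zpow_mul]
    exact zpow_mem hh m
  exact hnc ⟨a, fun x => ha' x (hKtop x)⟩
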